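/- arXiv:2407.05950 — 2 statements merged into one kernel-verified Lean document; each statement's English description precedes it below -/
import Mathlib

section
/- Let λ : ℕ → ℝ satisfy λ n ≥ 0 for all n, let β > 0 be such that n ↦ exp(−β · λ n) is summable, with Z(β) := ∑' n, exp(−β · λ n). Let E ≥ 0 and let p be a probability sequence such that n ↦ p n · λ n is summable and ∑' n, p n · λ n ≤ E. Then n ↦ negMulLog (p n) is summable and the Shannon entropy satisfies H(p) = ∑' n, negMulLog (p n) ≤ β·E + log (Z(β)). (This is the maximum entropy principle used in the paper: any state with energy at most E has entropy at most that of the thermal state, S(γ(E)) ≤ βE + log Z(β).) -/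
/-- **Maximum entropy principle**: a probability sequence `p` with energy
`∑ p n * λ n ≤ E` has Shannon entropy at most `β E + log Z(β)`,
where `Z(β) = ∑ exp(−β λ n)`. -/
theorem shannonEntropy_le_of_energy_le
    (lam : ℕ → ℝ) (hlam : ∀ n, 0 ≤ lam n)
    (β : ℝ) (hβ : 0 < β)
    (hZ : Summable fun n => Real.exp (-β * lam n))
    (E : ℝ) (hE : 0 ≤ E)
    (p : ℕ → ℝ) (hp : ∀ n, 0 ≤ p n) (hp1 : ∑' n, p n = 1)
    (hpl : Summable fun n => p n * lam n)
    (hEn : ∑' n, p n * lam n ≤ E) :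
    Summable (fun n => Real.negMulLog (p n))
      ∧ ∑' n, Real.negMulLog (p n)
          ≤ β * E + Real.log (∑' n, Real.exp (-β * lam n)) := by
  have hps : Summable p := by
    by_contra h
    rw [tsum_eq_zero_of_not_summable h] at hp1
    exact zero_ne_one hp1
  have hple : ∀ n, p n ≤ 1 := fun n => by
    rw [← hp1]
    exact hps.le_tsum n (fun j _ => hp j)
  set Z := ∑' n, Real.exp (-β * lam n) with hZdef
  have hZpos : 0 < Z := hZ.tsum_pos (fun n => (Real.exp_pos _).le) 0 (Real.exp_pos _)
  have key : ∀ n, Real.negMulLog (p n) ≤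
      β * (p n * lam n) + Real.log Z * p n + (Real.exp (-β * lam n) / Z - p n) := by
    intro n
    rcases (hp n).eq_or_lt with h | h
    · rw [← h]
      simp only [Real.negMulLog_zero, zero_mul, mul_zero, sub_zero, zero_add]
      positivity
    · have hq : 0 < Real.exp (-β * lam n) / Z := by positivity
      have h1 := Real.log_le_sub_one_of_pos (div_pos hq h)
      rw [Real.log_div hq.ne' h.ne', Real.log_div (Real.exp_pos _).ne' hZpos.ne',
        Real.log_exp] at h1
      have h2 := mul_le_mul_of_nonneg_left h1 h.le
      have h3 : p n * (Real.exp (-β * lam n) / Z / p n - 1)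
          = Real.exp (-β * lam n) / Z - p n := by
        rw [mul_sub, mul_div_cancel₀ _ h.ne', mul_one]
      rw [h3] at h2
      rw [Real.negMulLog]
      linarith
  have hs : HasSum (fun n => β * (p n * lam n) + Real.log Z * p n
      + (Real.exp (-β * lam n) / Z - p n))
      (β * (∑' n, p n * lam n) + Real.log Z * 1 + (Z / Z - 1)) := by
    have hp' : HasSum p 1 := hp1 ▸ hps.hasSum
    exact ((hpl.hasSum.mul_left β).add (hp'.mul_left _)).add
      ((hZ.hasSum.div_const Z).sub hp')
  have hsum : Summable (fun n => Real.negMulLog (p n)) :=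
    Summable.of_nonneg_of_le (fun n => Real.negMulLog_nonneg (hp n) (hple n)) key hs.summable
  refine ⟨hsum, ?_⟩
  have h4 := hasSum_le key hsum.hasSum hs
  rw [div_self hZpos.ne'] at h4
  have h5 := mul_le_mul_of_nonneg_left hEn hβ.le
  linarith
end

section
/- Let λ : ℕ → ℝ satisfy λ n ≥ 0 for all n and the Gibbs hypothesis: for every β > 0 the sequence n ↦ exp(−β · λ n) is summable. Then for every E ≥ 0 the set { H(p) : p a probability sequence with (n ↦ p n · λ n) summable and ∑' n, p n · λ n ≤ E } ⊆ ℝ is bounded above; in particular S_max(E) := sSup of this set is a finite real number (this is the finiteness of the entropy S(γ(E)) of the thermal state γ(E) of a Hamiltonian satisfying the Gibbs hypothesis). -/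
/-- Under the Gibbs hypothesis, for every `E ≥ 0` the set of entropies of
probability sequences with energy at most `E` is bounded above, so its
supremum `S_max(E) = S(γ(E))` is a finite real number. -/
theorem entropySet_bddAbove_of_gibbs
    (lam : ℕ → ℝ) (hlam : ∀ n, 0 ≤ lam n)
    (gibbs : ∀ β : ℝ, 0 < β → Summable fun n => Real.exp (-β * lam n))
    (E : ℝ) (hE : 0 ≤ E) :
    BddAbove {x : ℝ | ∃ p : ℕ → ℝ, (∀ n, 0 ≤ p n) ∧ (∑' n, p n = 1)
      ∧ Summable (fun n => p n * lam n) ∧ (∑' n, p n * lam n ≤ E)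
      ∧ x = ∑' n, Real.negMulLog (p n)} := by
  have hZ : Summable fun n => Real.exp (-lam n) := by simpa using gibbs 1 one_pos
  refine ⟨E + ∑' n, Real.exp (-lam n), ?_⟩
  rintro x ⟨p, hp, -, hs, hle, rfl⟩
  have key : ∀ n, Real.negMulLog (p n) ≤ p n * lam n + Real.exp (-lam n) := by
    intro n
    rcases (hp n).eq_or_lt with h | h
    · rw [← h]
      simp [Real.exp_nonneg]
    · have h1 := Real.log_le_sub_one_of_pos (div_pos (Real.exp_pos (-lam n)) h)
      rw [Real.log_div (Real.exp_pos _).ne' h.ne', Real.log_exp] at h1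
      have h2 := mul_le_mul_of_nonneg_left h1 h.le
      have h3 : p n * (Real.exp (-lam n) / p n - 1) = Real.exp (-lam n) - p n := by
        field_simp
      rw [h3] at h2
      unfold Real.negMulLog
      linarith
  by_cases hH : Summable fun n => Real.negMulLog (p n)
  · calc ∑' n, Real.negMulLog (p n) ≤ ∑' n, (p n * lam n + Real.exp (-lam n)) :=
          hH.tsum_le_tsum key (hs.add hZ)
      _ = ∑' n, p n * lam n + ∑' n, Real.exp (-lam n) := hs.tsum_add hZ
      _ ≤ _ := by linarith
  · rw [tsum_eq_zero_of_not_summable hH]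
    have : 0 ≤ ∑' n, Real.exp (-lam n) := tsum_nonneg fun n => Real.exp_nonneg (-lam n)
    linarith
end
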